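/- If s > 1 is not a perfect square, then the leading coefficient of the one-variable polynomial J_s(X,X) ∈ ℤ[X] is +1 or −1. -/

import Mathlib

open Polynomial Complex IntermediateField

noncomputable section

/-- 2×2 integer matrices. -/
abbrev Mat : Type := Matrix (Fin 2) (Fin 2) ℤ

/-- The modular group SL₂(ℤ). -/
abbrev SL2Z := Matrix.SpecialLinearGroup (Fin 2) ℤ

/-- A 2×2 integer matrix is primitive if the gcd of its four entries is 1. -/
def Mat.IsPrimitive (S : Mat) : Prop :=
  Nat.gcd (Nat.gcd (S 0 0).natAbs (S 0 1).natAbs)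
    (Nat.gcd (S 1 0).natAbs (S 1 1).natAbs) = 1

/-- Left equivalence of matrices under SL₂(ℤ). -/
def LeftEquiv (S T : Mat) : Prop := ∃ M : SL2Z, S = (M : Mat) * T

/-- Möbius action of an integer matrix on a complex number. -/
def moeb (S : Mat) (z : ℂ) : ℂ :=
  ((S 0 0 : ℂ) * z + (S 0 1 : ℂ)) / ((S 1 0 : ℂ) * z + (S 1 1 : ℂ))

/-- ψ(s) = s·∏_{p∣s}(1+1/p) = Σ_{d∣s squarefree} s/d. -/
def psi (s : ℕ) : ℕ := ∑ d ∈ s.divisors, if Squarefree d then s / d else 0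

/-- Eisenstein series g₂. -/
def g2C (z : ℂ) : ℂ :=
  60 * ∑' w : {v : ℤ × ℤ // v ≠ 0}, ((w.1.1 : ℂ) * z + (w.1.2 : ℂ)) ^ (-4 : ℤ)

/-- Eisenstein series g₃. -/
def g3C (z : ℂ) : ℂ :=
  140 * ∑' w : {v : ℤ × ℤ // v ≠ 0}, ((w.1.1 : ℂ) * z + (w.1.2 : ℂ)) ^ (-6 : ℤ)

/-- The discriminant Δ. -/
def discC (z : ℂ) : ℂ := g2C z ^ 3 - 27 * g3C z ^ 2

/-- The modular invariant j. -/
def jC (z : ℂ) : ℂ := 1728 * g2C z ^ 3 / discC z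

/-- A family of matrices is a complete system of representatives of the left SL₂(ℤ)-orbits
of primitive integer matrices of determinant `s`. -/
def IsOrbitReps (s : ℕ) {n : ℕ} (R : Fin n → Mat) : Prop :=
  (∀ ν, (R ν).IsPrimitive ∧ (R ν).det = (s : ℤ)) ∧
  ∀ T : Mat, T.IsPrimitive → T.det = (s : ℤ) → ∃! ν, LeftEquiv T (R ν)

/-- Evaluation of an integer polynomial at j(z). -/
def evalAtJ (z : ℂ) : Polynomial ℤ →+* ℂ := eval₂RingHom (Int.castRingHom ℂ) (jC z)

/-- J is the modular polynomial of level s: an element of ℤ[Y][X], monic in X of degree ψ(s),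
such that J(X, j(ω)) = ∏_ν (X − j(S_ν ω)) for every ω in the upper half-plane. -/
def IsModularPoly (s : ℕ) (J : Polynomial (Polynomial ℤ)) : Prop :=
  J.Monic ∧ J.natDegree = psi s ∧
  ∀ R : Fin (psi s) → Mat, IsOrbitReps s R → ∀ z : ℂ, 0 < z.im →
    J.map (evalAtJ z) = ∏ ν, (X - C (jC (moeb (R ν) z)))

/-- The one-variable polynomial J(X,X) obtained by setting Y = X. -/
def diagPoly (J : Polynomial (Polynomial ℤ)) : Polynomial ℤ := J.eval Polynomial.X

/-- φ_S(ω) = s¹²·Δ(Sω)/((cω+d)¹²·Δ(ω)). -/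
def phiS (S : Mat) (z : ℂ) : ℂ :=
  (S.det : ℂ) ^ 12 * discC (moeb S z) /
    (((S 1 0 : ℂ) * z + (S 1 1 : ℂ)) ^ 12 * discC z)

/-- K is an imaginary quadratic subfield of ℂ. -/
def IsImagQuad (K : Subfield ℂ) : Prop :=
  ∃ θ : ℂ, 0 < θ.im ∧ Module.finrank ℚ ℚ⟮θ⟯ = 2 ∧ K = ℚ⟮θ⟯.toSubfield

/-- O is an order of the field K: a subring of K which is a finitely generated additive
group containing a ℚ-basis of K. -/
structure IsOrder (K : Subfield ℂ) (O : Subring ℂ) : Prop where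
  le : (O : Set ℂ) ⊆ (K : Set ℂ)
  fg : O.toAddSubgroup.FG
  full : ∀ x ∈ K, ∃ n : ℤ, n ≠ 0 ∧ (n : ℂ) * x ∈ O

/-- The lattice spanned by a and b. -/
def zLat (a b : ℂ) : AddSubgroup ℂ := AddSubgroup.closure {a, b}

/-- (a,b) is a ℤ-basis (with Im(a/b) > 0) of a proper (characteristic) ideal of the
order O of K: the lattice ℤa+ℤb lies in K and its multiplier ring is exactly O. -/
def IsIdealBasis (K : Subfield ℂ) (O : Subring ℂ) (a b : ℂ) : Prop :=
  0 < (a / b).im ∧ a ∈ K ∧ b ∈ K ∧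
  ∀ lam : ℂ, lam ∈ O ↔ (lam * a ∈ zLat a b ∧ lam * b ∈ zLat a b)

/-- Two lattices differ by a nonzero scalar factor. -/
def LatEquiv (A B : AddSubgroup ℂ) : Prop :=
  ∃ μ : ℂ, μ ≠ 0 ∧ (B : Set ℂ) = (fun z => μ * z) '' (A : Set ℂ)

/-- The two ideals with the given bases lie in the same ideal class. -/
def IdealEquiv (a b a' b' : ℂ) : Prop := LatEquiv (zLat a b) (zLat a' b')

/-- Product of two lattices. -/
def latMul (A B : AddSubgroup ℂ) : AddSubgroup ℂ :=
  AddSubgroup.closure {z : ℂ | ∃ x ∈ A, ∃ y ∈ B, z = x * y}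

/-- μ is a primitive element of the order O : μ ∈ O and μ/t ∉ O for every integer t > 1. -/
def IsPrimElem (O : Subring ℂ) (μ : ℂ) : Prop :=
  μ ∈ O ∧ ∀ t : ℤ, 1 < t → μ / (t : ℂ) ∉ O

/-- μ and μ' are associated in O (differ by a unit of O). -/
def UnitAssoc (O : Subring ℂ) (μ μ' : ℂ) : Prop :=
  ∃ ε : ℂ, ε ∈ O ∧ ε ≠ 0 ∧ ε⁻¹ ∈ O ∧ μ' = ε * μ

/-- The ring of integers of a subfield K of ℂ, as a subring of ℂ. -/
def OK (K : Subfield ℂ) : Subring ℂ := (integralClosure ℤ ℂ).toSubring ⊓ K.toSubring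

/-- The index of an order O in the maximal order of K (for a quadratic field this
equals the conductor f of O). -/
def condIndex (K : Subfield ℂ) (O : Subring ℂ) : ℕ :=
  (O.toAddSubgroup.addSubgroupOf (OK K).toAddSubgroup).index

/-- The lattice in ℂ attached to an ideal of the maximal order of K. -/
def idealLat (K : Subfield ℂ) (I : Ideal ↥(OK K)) : AddSubgroup ℂ :=
  AddSubgroup.closure {z : ℂ | ∃ x ∈ I, (x : ℂ) = z}

/-- The lattice attached to the O-ideal I ∩ O, for an ideal I of the maximal order. -/
def primeOrderLat (K : Subfield ℂ) (O : Subring ℂ) (I : Ideal ↥(OK K)) : AddSubgroup ℂ :=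
  AddSubgroup.closure {z : ℂ | z ∈ O ∧ ∃ x ∈ I, (x : ℂ) = z}

/-- The set of all class invariants j(k) of ideal classes of the order O. -/
def classInvSet (K : Subfield ℂ) (O : Subring ℂ) : Set ℂ :=
  {w : ℂ | ∃ a b : ℂ, IsIdealBasis K O a b ∧ w = jC (a / b)}

/-- The ring class field Ω_R : the subfield of ℂ generated by K together with all
class invariants of the order O. -/
def ringClassField (K : Subfield ℂ) (O : Subring ℂ) : Subfield ℂ :=
  Subfield.closure ((K : Set ℂ) ∪ classInvSet K O)

theorem le_ringClassField (K : Subfield ℂ) (O : Subring ℂ) : K ≤ ringClassField K O :=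
  fun _ hx => Subfield.subset_closure (Set.mem_union_left _ hx)

noncomputable instance rcfAlgebra (K : Subfield ℂ) (O : Subring ℂ) :
    Algebra ↥K ↥(ringClassField K O) :=
  (Subfield.inclusion (le_ringClassField K O)).toAlgebra

theorem OK_mono {K L : Subfield ℂ} (h : K ≤ L) : OK K ≤ OK L := by
  intro x hx
  rw [OK, Subring.mem_inf] at hx ⊢
  exact ⟨hx.1, h hx.2⟩

/-- 𝔭 splits completely in L/K: the extension of 𝔭 to the ring of integers of L is a
product of pairwise distinct primes, each of residue degree one over 𝔭. -/
def SplitsCompletely (K L : Subfield ℂ) (h : K ≤ L) (p : Ideal ↥(OK K)) : Prop :=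
  ∃ (g : ℕ) (Q : Fin g → Ideal ↥(OK L)),
    Function.Injective Q ∧ (∀ i, (Q i).IsPrime) ∧
    Ideal.map (Subring.inclusion (OK_mono h)) p = ∏ i, Q i ∧
    ∀ i, Nat.card (↥(OK L) ⧸ Q i) = Nat.card (↥(OK K) ⧸ p)

/-- L is a finite extension of ℚ (a number field) inside ℂ. -/
def FinDimOverQ (L : Subfield ℂ) : Prop :=
  ∃ t : Finset ℂ, (L : Set ℂ) ⊆ (Submodule.span ℚ (t : Set ℂ) : Submodule ℚ ℂ)

/-- Lattice Eisenstein sums Σ_{w∈L, w≠0} w^{-k}. -/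
def gkL (k : ℕ) (L : AddSubgroup ℂ) : ℂ :=
  ∑' w : {w : ℂ // w ∈ L ∧ w ≠ 0}, (w : ℂ) ^ (-(k : ℤ))

def g2L (L : AddSubgroup ℂ) : ℂ := 60 * gkL 4 L
def g3L (L : AddSubgroup ℂ) : ℂ := 140 * gkL 6 L
def discL (L : AddSubgroup ℂ) : ℂ := g2L L ^ 3 - 27 * g3L L ^ 2

/-- The Weierstrass ℘-function of a lattice. -/
def wpL (z : ℂ) (L : AddSubgroup ℂ) : ℂ :=
  z ^ (-2 : ℤ) + ∑' w : {w : ℂ // w ∈ L ∧ w ≠ 0},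
    ((z - (w : ℂ)) ^ (-2 : ℤ) - (w : ℂ) ^ (-2 : ℤ))

/-- The Weber function τ_R(z, 𝔴), where e is the number of units of R. -/
def weber (e : ℕ) (z : ℂ) (L : AddSubgroup ℂ) : ℂ :=
  if e = 4 then 2 ^ 8 * 3 ^ 4 * (g2L L ^ 2 / discL L) * wpL z L ^ 2
  else if e = 6 then -(2 ^ 9 * 3 ^ 6) * (g3L L / discL L) * wpL z L ^ 3
  else -(2 ^ 7 * 3 ^ 5) * (g2L L * g3L L / discL L) * wpL z L

/-- The number of units (roots of unity) in the ring of integers of K. -/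
def numRootsOfUnity (K : Subfield ℂ) : ℕ :=
  Nat.card {x : ℂ // x ∈ OK K ∧ ∃ n : ℕ, 0 < n ∧ x ^ n = 1}

/-- λ ≡ 1 mod* 𝔪 (multiplicative congruence): λ = β/γ with β, γ integral and prime
to 𝔪 and β ≡ γ mod 𝔪. -/
def MulCongOne (K : Subfield ℂ) (m : Ideal ↥(OK K)) (lam : ℂ) : Prop :=
  ∃ β γ : ↥(OK K), (γ : ℂ) ≠ 0 ∧ lam = (β : ℂ) / (γ : ℂ) ∧
    Ideal.span {β} ⊔ m = ⊤ ∧ Ideal.span {γ} ⊔ m = ⊤ ∧ β - γ ∈ m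

/-- The Dedekind eta function. -/
def dedekindEta (z : ℂ) : ℂ :=
  Complex.exp (Real.pi * Complex.I * z / 12) *
    ∏' n : ℕ, (1 - Complex.exp (2 * Real.pi * Complex.I * ((n : ℂ) + 1) * z))

/-- ζ₂₄ = e^{2πi/24}. -/
def zeta24 : ℂ := Complex.exp (2 * Real.pi * Complex.I / 24)

/-- The image of the basis (a,b) under an integer matrix. -/
def matBasis (P : Mat) (a b : ℂ) : ℂ × ℂ :=
  ((P 0 0 : ℂ) * a + (P 0 1 : ℂ) * b, (P 1 0 : ℂ) * a + (P 1 1 : ℂ) * b)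

/-- The image of the basis (a,b) under a rational matrix. -/
def matBasisQ (B : Matrix (Fin 2) (Fin 2) ℚ) (a b : ℂ) : ℂ × ℂ :=
  ((B 0 0 : ℂ) * a + (B 0 1 : ℂ) * b, (B 1 0 : ℂ) * a + (B 1 1 : ℂ) * b)

/-- φ_B for a rational matrix B of positive determinant. -/
def phiQ (B : Matrix (Fin 2) (Fin 2) ℚ) (z : ℂ) : ℂ :=
  (B.det : ℂ) ^ 12 *
      discC (((B 0 0 : ℂ) * z + (B 0 1 : ℂ)) / ((B 1 0 : ℂ) * z + (B 1 1 : ℂ))) /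
    (((B 1 0 : ℂ) * z + (B 1 1 : ℂ)) ^ 12 * discC z)

/-- The lattice attached to the complex conjugate of an ideal of the maximal order. -/
def conjIdealLat (K : Subfield ℂ) (I : Ideal ↥(OK K)) : AddSubgroup ℂ :=
  AddSubgroup.closure {z : ℂ | ∃ x ∈ I, (starRingEnd ℂ) (x : ℂ) = z}

/-- The triangular representatives (a b; 0 d), a·d = s, gcd(a,b,d) = 1, 0 ≤ b < d,
encoded as triples (a, b, d). -/
def triReps (s : ℕ) : Finset (ℕ × ℕ × ℕ) :=
  (Finset.range (s + 1) ×ˢ Finset.range (s + 1) ×ˢ Finset.range (s + 1)).filter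
    (fun t => 0 < t.1 ∧ 0 < t.2.2 ∧ t.1 * t.2.2 = s ∧
      Nat.gcd t.1 (Nat.gcd t.2.1 t.2.2) = 1 ∧ t.2.1 < t.2.2)

section

open Filter Topology EisensteinSeries ModularForm
open UpperHalfPlane hiding I

lemma tsum_ne_zero_eq_riemannZeta_mul_E {k : ℕ} (hk : 3 ≤ k) (z : ℍ) :
    ∑' w : {v : ℤ × ℤ // v ≠ 0}, ((w.1.1 : ℂ) * z + (w.1.2 : ℂ)) ^ (-(k : ℤ)) =
      2 * riemannZeta k * E hk z := by
  have hE : E hk z = (1 / 2 : ℂ) * eisensteinSeries (N := 1) 0 k z := rfl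
  have h := tsum_eisSummand_eq_riemannZeta_mul_eisensteinSeries hk z
  rw [← (finTwoArrowEquiv ℤ).symm.tsum_eq] at h
  rw [hE, show 2 * riemannZeta k * ((1 / 2 : ℂ) * eisensteinSeries (N := 1) 0 k z) =
    riemannZeta k * eisensteinSeries (N := 1) 0 k z by ring, ← h]
  refine (tsum_subtype_eq_of_support_subset (s := {v : ℤ × ℤ | v ≠ 0})
    (f := fun v : ℤ × ℤ ↦ ((v.1 : ℂ) * z + (v.2 : ℂ)) ^ (-(k : ℤ))) ?_).trans ?_
  · rintro v hv rfl
    simp [show k ≠ 0 by lia] at hv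
  · simp [finTwoArrowEquiv_symm_apply, eisSummand]

lemma riemannZeta_six : riemannZeta 6 = (Real.pi : ℂ) ^ 6 / 945 := by
  have h := riemannZeta_two_mul_nat (k := 3) (by norm_num)
  norm_num [show _root_.bernoulli 6 = 1 / 42 by decide +kernel, Nat.factorial] at h
  rw [h]
  ring

lemma g2C_eq (z : ℍ) : g2C z = 4 / 3 * (Real.pi : ℂ) ^ 4 * E₄ z := by
  have h := tsum_ne_zero_eq_riemannZeta_mul_E (k := 4) (by norm_num) z
  push_cast at h
  rw [g2C, h, riemannZeta_four]
  ring

lemma g3C_eq (z : ℍ) : g3C z = 8 / 27 * (Real.pi : ℂ) ^ 6 * E₆ z := by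
  have h := tsum_ne_zero_eq_riemannZeta_mul_E (k := 6) (by norm_num) z
  push_cast at h
  rw [g3C, h, riemannZeta_six]
  ring

lemma jC_eq (z : ℍ) : jC z = E₄ z ^ 3 / ModularForm.discriminant z := by
  have hpi : (Real.pi : ℂ) ≠ 0 := mod_cast Real.pi_ne_zero
  have hd : discC z = 4096 * (Real.pi : ℂ) ^ 12 * ModularForm.discriminant z := by
    rw [discC, g2C_eq, g3C_eq, discriminant_eq_E₄_cube_sub_E₆_sq]
    ring
  have := discriminant_ne_zero z
  rw [jC, hd, g2C_eq]
  field_simp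
  ring

lemma tendsto_E_atImInfty {k : ℕ} (hk : 3 ≤ k) (hk2 : Even k) :
    Tendsto (E hk) atImInfty (𝓝 1) := by
  have h1 := UpperHalfPlane.qExpansion_coeff_zero one_pos
    (ModularFormClass.analyticAt_cuspFunction_zero (E hk) one_pos one_mem_strictPeriods_SL)
    (SlashInvariantFormClass.periodic_comp_ofComplex (E hk) one_mem_strictPeriods_SL)
  rw [E_qExpansion_coeff_zero hk hk2] at h1
  obtain ⟨c, hc, h⟩ := ModularFormClass.exp_decay_sub_atImInfty' (E hk)
  have h2 : Tendsto (fun τ : ℍ ↦ Real.exp (-c * τ.im)) atImInfty (𝓝 0) := by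
    refine Real.tendsto_exp_atBot.comp ?_
    simp only [neg_mul]
    exact tendsto_neg_atTop_atBot.comp ((tendsto_comap (f := UpperHalfPlane.im)).const_mul_atTop hc)
  simpa [← h1] using (h.trans_tendsto h2).add_const 1

/-- `|j(τ)|` grows like `|q|⁻¹` at `i∞`. -/
lemma tendsto_norm_jC_mul_exp :
    Tendsto (fun τ : ℍ ↦ ‖jC τ‖ * Real.exp (-2 * Real.pi * τ.im)) atImInfty (𝓝 1) := by
  have h := ((tendsto_E_atImInfty (k := 4) (by norm_num) ⟨2, rfl⟩).pow 3).div
    tendsto_atImInfty_tprod_one_sub_eta_q_pow one_ne_zero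
  have h' := h.norm
  simp only [one_pow, div_one, norm_one] at h'
  refine h'.congr fun τ ↦ ?_
  have hq : ‖Function.Periodic.qParam 1 τ‖ = Real.exp (-2 * Real.pi * τ.im) := by
    simp [Function.Periodic.qParam, Complex.norm_exp]
  rw [jC_eq, discriminant_eq_q_prod, ← hq, Pi.div_apply]
  have hq0 : ‖Function.Periodic.qParam 1 τ‖ ≠ 0 := by rw [hq]; positivity
  simp only [norm_div, norm_mul]
  field_simp

lemma tendsto_norm_jC_triangular {a d : ℝ} (ha : 0 < a) (hd : 0 < d) (b : ℝ) :
    Tendsto (fun y : ℝ ↦ ‖jC ((a * (y * I) + b) / d)‖ * Real.exp (-(2 * Real.pi * (a / d)) * y))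
      atTop (𝓝 1) := by
  have him : ∀ y : ℝ, (((a : ℂ) * (y * I) + b) / d).im = a / d * y := fun y ↦ by
    rw [Complex.div_ofReal_im]
    simp
    ring
  have hτ : Tendsto (fun y : ℝ ↦ ofComplex (((a : ℂ) * (y * I) + b) / d)) atTop atImInfty := by
    refine tendsto_comap_im_ofComplex.comp (tendsto_comap_iff.mpr ?_)
    simp only [Function.comp_def, him]
    exact tendsto_id.const_mul_atTop (div_pos ha hd)
  refine (tendsto_norm_jC_mul_exp.comp hτ).congr' ?_
  filter_upwards [eventually_gt_atTop 0] with y hy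
  have hpos : 0 < (((a : ℂ) * (y * I) + b) / d).im := by rw [him]; positivity
  rw [Function.comp_apply, ofComplex_apply_of_im_pos hpos, ← UpperHalfPlane.coe_im, him]
  ring_nf

lemma tendsto_norm_sub_mul_exp {A B : ℝ → ℂ} {α β : ℝ} (hne : α ≠ β)
    (hA : Tendsto (fun y ↦ ‖A y‖ * Real.exp (-α * y)) atTop (𝓝 1))
    (hB : Tendsto (fun y ↦ ‖B y‖ * Real.exp (-β * y)) atTop (𝓝 1)) :
    Tendsto (fun y ↦ ‖A y - B y‖ * Real.exp (-max α β * y)) atTop (𝓝 1) := by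
  wlog h : β < α generalizing A B α β
  · simpa only [norm_sub_rev, max_comm] using
      this hne.symm hB hA (lt_of_le_of_ne (not_lt.mp h) hne)
  rw [max_eq_left h.le]
  have hexp : Tendsto (fun y : ℝ ↦ Real.exp (-(α - β) * y)) atTop (𝓝 0) :=
    Real.tendsto_exp_atBot.comp
      (tendsto_id.const_mul_atTop_of_neg (neg_neg_of_pos (sub_pos.mpr h)))
  have hB0 : Tendsto (fun y ↦ ‖B y‖ * Real.exp (-α * y)) atTop (𝓝 0) := by
    have hmul := hB.mul hexp
    rw [mul_zero] at hmul
    refine hmul.congr fun y ↦ ?_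
    rw [mul_assoc, ← Real.exp_add]
    ring_nf
  have hdiff : Tendsto (fun y ↦ ‖A y - B y‖ * Real.exp (-α * y) - ‖A y‖ * Real.exp (-α * y))
      atTop (𝓝 0) := by
    refine squeeze_zero_norm (fun y ↦ ?_) hB0
    rw [← sub_mul, norm_mul, Real.norm_eq_abs, Real.norm_of_nonneg (Real.exp_pos _).le]
    gcongr
    simpa using abs_norm_sub_norm_le (A y - B y) (A y)
  simpa using hdiff.add hA

lemma tendsto_norm_eval₂_mul_exp (P : ℤ[X]) {w : ℝ → ℂ} {c : ℝ} (hc : 0 < c)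
    (hw : Tendsto (fun y ↦ ‖w y‖ * Real.exp (-c * y)) atTop (𝓝 1)) :
    Tendsto (fun y ↦ ‖P.eval₂ (Int.castRingHom ℂ) (w y)‖ *
      Real.exp (-(P.natDegree * c) * y)) atTop (𝓝 ‖(P.leadingCoeff : ℂ)‖) := by
  have hexp : Tendsto (fun y : ℝ ↦ Real.exp (c * y)) atTop atTop :=
    Real.tendsto_exp_atTop.comp (tendsto_id.const_mul_atTop hc)
  have hnorm : Tendsto (fun y ↦ ‖w y‖) atTop atTop :=
    (hw.pos_mul_atTop one_pos hexp).congr fun y ↦ by simp [mul_assoc, ← Real.exp_add]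
  have hinv : Tendsto (fun y ↦ (w y)⁻¹) atTop (𝓝 0) :=
    tendsto_inv₀_cobounded.comp (tendsto_norm_atTop_iff_cobounded.mp hnorm)
  have hcont : Continuous fun x : ℂ ↦ P.reverse.eval₂ (Int.castRingHom ℂ) x :=
    P.reverse.continuous_eval₂ _
  have hrev : Tendsto (fun y ↦ ‖P.reverse.eval₂ (Int.castRingHom ℂ) (w y)⁻¹‖) atTop
      (𝓝 ‖(P.leadingCoeff : ℂ)‖) := by
    have := ((hcont.tendsto 0).comp hinv).norm
    simpa [eval₂_at_zero, coeff_zero_reverse] using this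
  have h := hrev.mul (hw.pow P.natDegree)
  rw [one_pow, mul_one] at h
  refine h.congr' ?_
  filter_upwards [hnorm.eventually_gt_atTop 0] with y hy
  have : Invertible (w y) := invertibleOfNonzero (norm_pos_iff.mp hy)
  rw [← eval₂_reverse_mul_pow (Int.castRingHom ℂ) (w y) P, invOf_eq_inv, norm_mul, norm_pow,
    mul_pow, ← Real.exp_nat_mul]
  ring_nf

lemma abs_leadingCoeff_eq_one_of_tendsto (P : ℤ[X]) {w : ℝ → ℂ} {c μ : ℝ} (hc : 0 < c)
    (hw : Tendsto (fun y ↦ ‖w y‖ * Real.exp (-c * y)) atTop (𝓝 1))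
    (hP : Tendsto (fun y ↦ ‖P.eval₂ (Int.castRingHom ℂ) (w y)‖ * Real.exp (-μ * y))
      atTop (𝓝 1)) :
    |P.leadingCoeff| = 1 := by
  have hP0 : P ≠ 0 := by
    rintro rfl
    simp [tendsto_const_nhds_iff] at hP
  have hl : ‖(P.leadingCoeff : ℂ)‖ ≠ 0 := by simpa using hP0
  have h := (tendsto_norm_eval₂_mul_exp P hc hw).div hP one_ne_zero
  rw [div_one] at h
  have h' : Tendsto (fun y : ℝ ↦ Real.exp ((μ - P.natDegree * c) * y)) atTop
      (𝓝 ‖(P.leadingCoeff : ℂ)‖) := by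
    refine h.congr' ?_
    filter_upwards [hP.eventually_ne one_ne_zero] with y hy
    simp only [Pi.div_apply]
    rw [mul_div_mul_left _ _ (left_ne_zero_of_mul hy), ← Real.exp_sub]
    ring_nf
  rcases lt_trichotomy (μ - P.natDegree * c) 0 with hlt | heq | hgt
  · exact absurd (tendsto_nhds_unique h' (Real.tendsto_exp_atBot.comp
      (tendsto_id.const_mul_atTop_of_neg hlt))) hl
  · simp only [heq, zero_mul, Real.exp_zero, tendsto_const_nhds_iff] at h'
    have : ‖(P.leadingCoeff : ℂ)‖ = |(P.leadingCoeff : ℝ)| := by simp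
    rw [this] at h'
    exact_mod_cast h'.symm
  · exact absurd h' (not_tendsto_nhds_of_tendsto_atTop (Real.tendsto_exp_atTop.comp
      (tendsto_id.const_mul_atTop hgt)) _)

lemma eval₂_diagPoly (J : Polynomial (Polynomial ℤ)) (z : ℂ) :
    (diagPoly J).eval₂ (Int.castRingHom ℂ) (jC z) = (J.map (evalAtJ z)).eval (jC z) := by
  have hX : evalAtJ z X = jC z := by simp [evalAtJ]
  rw [eval_map, ← hX, eval₂_at_apply, hX]
  rfl

lemma abs_leadingCoeff_diagPoly_eq_one {s : ℕ} (hsq : ¬ IsSquare s)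
    {J : Polynomial (Polynomial ℤ)} (hJ : IsModularPoly s J) {R : Fin (psi s) → Mat}
    (hR : IsOrbitReps s R)
    (htri : ∀ ν, ∃ a b d : ℕ, 0 < a ∧ 0 < d ∧ a * d = s ∧ R ν = !![(a : ℤ), b; 0, d]) :
    |(diagPoly J).leadingCoeff| = 1 := by
  choose a b d ha hd had hRν using htri
  have ha' : ∀ ν, (0 : ℝ) < a ν := fun ν ↦ mod_cast ha ν
  have hd' : ∀ ν, (0 : ℝ) < d ν := fun ν ↦ mod_cast hd ν
  have hj : Tendsto (fun y : ℝ ↦ ‖jC (y * I)‖ * Real.exp (-(2 * Real.pi) * y)) atTop (𝓝 1) := by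
    simpa using tendsto_norm_jC_triangular one_pos one_pos 0
  refine abs_leadingCoeff_eq_one_of_tendsto (diagPoly J) Real.two_pi_pos hj
    (μ := ∑ ν, max (2 * Real.pi) (2 * Real.pi * (a ν / d ν))) ?_
  have hfac : ∀ ν, Tendsto (fun y : ℝ ↦ ‖jC (y * I) - jC ((a ν * (y * I) + b ν) / d ν)‖ *
      Real.exp (-max (2 * Real.pi) (2 * Real.pi * (a ν / d ν)) * y)) atTop (𝓝 1) := by
    intro ν
    refine tendsto_norm_sub_mul_exp ?_ hj (by
      simpa using tendsto_norm_jC_triangular (ha' ν) (hd' ν) (b ν))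
    intro h
    have h1 : (a ν : ℝ) = d ν := by
      have := hd' ν
      field_simp at h
      exact h.symm
    exact hsq ⟨a ν, by rw [← had ν, Nat.cast_injective (R := ℝ) h1]⟩
  have hprod := tendsto_finsetProd Finset.univ fun ν _ ↦ hfac ν
  simp only [Finset.prod_const_one] at hprod
  refine hprod.congr' ?_
  filter_upwards [eventually_gt_atTop 0] with y hy
  rw [eval₂_diagPoly, hJ.2.2 R hR (y * I) (by simpa using hy), eval_prod, norm_prod,
    Finset.prod_mul_distrib, ← Real.exp_sum, ← Finset.sum_mul, Finset.sum_neg_distrib]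
  simp [hRν, moeb]

end

lemma Mat.isPrimitive_iff {S : Mat} :
    S.IsPrimitive ↔ ∀ k : ℕ, (∀ i j, (k : ℤ) ∣ S i j) → k = 1 := by
  constructor
  · intro h k hk
    refine Nat.dvd_one.mp (h ▸ ?_)
    simp only [Nat.dvd_gcd_iff, ← Int.natCast_dvd, hk, and_self]
  · intro h
    refine h _ fun i j ↦ Int.natCast_dvd.mpr ?_
    fin_cases i <;> fin_cases j
    · exact (Nat.gcd_dvd_left _ _).trans (Nat.gcd_dvd_left _ _)
    · exact (Nat.gcd_dvd_left _ _).trans (Nat.gcd_dvd_right _ _)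
    · exact (Nat.gcd_dvd_right _ _).trans (Nat.gcd_dvd_left _ _)
    · exact (Nat.gcd_dvd_right _ _).trans (Nat.gcd_dvd_right _ _)

lemma Mat.isPrimitive_triangular_iff {a b d : ℕ} :
    Mat.IsPrimitive !![(a : ℤ), b; 0, d] ↔ Nat.gcd a (Nat.gcd b d) = 1 := by
  simp [Mat.IsPrimitive, Nat.gcd_assoc]

lemma LeftEquiv.symm {S T : Mat} (h : LeftEquiv S T) : LeftEquiv T S := by
  obtain ⟨M, rfl⟩ := h
  refine ⟨M⁻¹, ?_⟩
  rw [← Matrix.mul_assoc, ← Matrix.SpecialLinearGroup.coe_mul]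
  simp

lemma LeftEquiv.trans {S T U : Mat} (h : LeftEquiv S T) (h' : LeftEquiv T U) :
    LeftEquiv S U := by
  obtain ⟨M, rfl⟩ := h
  obtain ⟨N, rfl⟩ := h'
  exact ⟨M * N, by rw [Matrix.SpecialLinearGroup.coe_mul, Matrix.mul_assoc]⟩

lemma LeftEquiv.isPrimitive {S T : Mat} (h : LeftEquiv S T) (hS : S.IsPrimitive) :
    T.IsPrimitive := by
  rw [Mat.isPrimitive_iff] at hS ⊢
  obtain ⟨M, rfl⟩ := h
  refine fun k hk ↦ hS k fun i j ↦ ?_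
  rw [Matrix.mul_apply]
  exact Finset.dvd_sum fun l _ ↦ (hk l j).mul_left _

lemma exists_leftEquiv_triangular {s : ℕ} (hs : 0 < s) {S : Mat} (hS : S.det = s) :
    ∃ a b d : ℕ, 0 < a ∧ b < d ∧ a * d = s ∧ LeftEquiv S !![(a : ℤ), b; 0, d] := by
  have hs' : (s : ℤ) ≠ 0 := by positivity
  have hmul : ∀ (M : SL2Z) (B : FixedDetMatrix (Fin 2) ℤ s) {T : Mat}, LeftEquiv B.1 T →
      LeftEquiv (M • B).1 T := fun M B T h ↦ LeftEquiv.trans ⟨M, rfl⟩ h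
  suffices ∀ A : FixedDetMatrix (Fin 2) ℤ s,
      ∃ a b d : ℕ, 0 < a ∧ b < d ∧ a * d = s ∧ LeftEquiv A.1 !![(a : ℤ), b; 0, d] from
    this ⟨S, hS⟩
  intro A
  induction A using FixedDetMatrices.induction_on hs' with
  | h0 A h10 h00 h01 h11 =>
    have hdet : A.1 0 0 * A.1 1 1 = s := by
      simpa [Matrix.det_fin_two, h10] using A.2
    have hd : 0 < A.1 1 1 := pos_of_mul_pos_right (by rw [hdet]; exact_mod_cast hs) h00.le
    rw [abs_of_nonneg h01, abs_of_pos hd] at h11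
    refine ⟨(A.1 0 0).toNat, (A.1 0 1).toNat, (A.1 1 1).toNat, by lia, by lia, ?_, 1, ?_⟩
    · zify
      rw [Int.toNat_of_nonneg h00.le, Int.toNat_of_nonneg hd.le, hdet]
    · ext i j
      fin_cases i <;> fin_cases j <;> simp [h10, h00.le, h01, hd.le]
  | hS B h =>
    obtain ⟨a, b, d, ha, hb, had, h⟩ := h
    exact ⟨a, b, d, ha, hb, had, hmul _ B h⟩
  | hT B h =>
    obtain ⟨a, b, d, ha, hb, had, h⟩ := h
    exact ⟨a, b, d, ha, hb, had, hmul _ B h⟩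

lemma LeftEquiv.triangular_eq {a b d a' b' d' : ℕ} (ha : 0 < a) (ha' : 0 < a') (hb : b < d)
    (hb' : b' < d') (h : LeftEquiv !![(a : ℤ), b; 0, d] !![(a' : ℤ), b'; 0, d']) :
    a = a' ∧ b = b' ∧ d = d' := by
  obtain ⟨M, hM⟩ := h
  have hdet := M.det_coe
  rw [Matrix.det_fin_two] at hdet
  have h00 := congr_fun₂ hM 0 0
  have h01 := congr_fun₂ hM 0 1
  have h10 := congr_fun₂ hM 1 0
  have h11 := congr_fun₂ hM 1 1
  simp only [Matrix.mul_apply, Fin.sum_univ_two, Matrix.of_apply, Matrix.cons_val',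
    Matrix.cons_val_zero, Matrix.cons_val_one, Matrix.cons_val_fin_one, mul_zero,
    add_zero] at h00 h01 h10 h11
  generalize M.1 0 0 = p at *
  generalize M.1 0 1 = q at *
  generalize M.1 1 0 = r at *
  generalize M.1 1 1 = t at *
  have hr : r = 0 := by
    rcases mul_eq_zero.mp h10.symm with h | h
    · exact h
    · lia
  subst hr
  have hp : 0 < p := pos_of_mul_pos_left (h00 ▸ by positivity) (by positivity : (0 : ℤ) ≤ a')
  have hp1 : p = 1 := Int.eq_one_of_mul_eq_one_right hp.le (by simpa using hdet)
  subst hp1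
  have ht1 : t = 1 := by simpa using hdet
  subst ht1
  have hdd : d = d' := by simpa using h11
  subst hdd
  have hq : q = 0 := by
    have h1 : q * d < 1 * d := by lia
    have h2 : -1 * d < q * d := by lia
    have := lt_of_mul_lt_mul_right h1 (by positivity)
    have := lt_of_mul_lt_mul_right h2 (by positivity)
    lia
  subst hq
  exact ⟨by simpa using h00, by simpa using h01, rfl⟩

lemma mem_triReps {s : ℕ} (hs : 0 < s) {a b d : ℕ} :
    (a, b, d) ∈ triReps s ↔ a * d = s ∧ Nat.gcd a (Nat.gcd b d) = 1 ∧ b < d := by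
  simp only [triReps, Finset.mem_filter, Finset.mem_product, Finset.mem_range]
  constructor
  · tauto
  · rintro ⟨h, hg, hb⟩
    have ha : 0 < a := Nat.pos_of_ne_zero (by rintro rfl; lia)
    have had : a ≤ s := Nat.le_of_dvd hs ⟨d, h.symm⟩
    have hds : d ≤ s := Nat.le_of_dvd hs (Dvd.intro_left a h)
    refine ⟨⟨?_, ?_, ?_⟩, ha, ?_, h, hg, hb⟩ <;> lia

/-- The positive integers whose square divides `s`. -/
def sqDivisors (s : ℕ) : Finset ℕ := s.divisors.filter fun k ↦ k ^ 2 ∣ s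

lemma mem_sqDivisors {s : ℕ} (hs : 0 < s) {k : ℕ} : k ∈ sqDivisors s ↔ k ^ 2 ∣ s := by
  simp only [sqDivisors, Finset.mem_filter, Nat.mem_divisors, and_iff_right_iff_imp]
  exact fun h ↦ ⟨(dvd_pow_self k two_ne_zero).trans h, hs.ne'⟩

lemma pos_of_sq_dvd {s k : ℕ} (hs : 0 < s) (h : k ^ 2 ∣ s) : 0 < k :=
  Nat.pos_of_ne_zero (by rintro rfl; simp at h; lia)

lemma eq_of_sum_sqDivisors_eq {f g : ℕ → ℕ}
    (h : ∀ s, 0 < s → ∑ k ∈ sqDivisors s, f (s / k ^ 2) = ∑ k ∈ sqDivisors s, g (s / k ^ 2))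
    {s : ℕ} (hs : 0 < s) : f s = g s := by
  induction s using Nat.strong_induction_on with
  | _ s ih =>
    have h1 : 1 ∈ sqDivisors s := (mem_sqDivisors hs).mpr (by simp)
    have hsum := h s hs
    rw [← Finset.add_sum_erase _ _ h1, ← Finset.add_sum_erase _ _ h1] at hsum
    have : ∑ k ∈ (sqDivisors s).erase 1, f (s / k ^ 2) =
        ∑ k ∈ (sqDivisors s).erase 1, g (s / k ^ 2) := by
      refine Finset.sum_congr rfl fun k hk ↦ ?_
      rw [Finset.mem_erase, mem_sqDivisors hs] at hk
      have hk0 := pos_of_sq_dvd hs hk.2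
      exact ih _ (Nat.div_lt_self hs (Nat.one_lt_pow two_ne_zero (by lia)))
        (Nat.div_pos (Nat.le_of_dvd hs hk.2) (by positivity))
    simpa [this] using hsum

lemma exists_eq_mul_gcd_eq_one (a b : ℕ) {d : ℕ} (hd : 0 < d) :
    ∃ c a' b' d' : ℕ, 0 < c ∧ Nat.gcd a' (Nat.gcd b' d') = 1 ∧
      a = c * a' ∧ b = c * b' ∧ d = c * d' := by
  have hc : 0 < Nat.gcd a (Nat.gcd b d) :=
    Nat.gcd_pos_of_pos_right _ (Nat.gcd_pos_of_pos_right _ hd)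
  obtain ⟨a', ha⟩ := Nat.gcd_dvd_left a (Nat.gcd b d)
  obtain ⟨b', hb⟩ := (Nat.gcd_dvd_right a (Nat.gcd b d)).trans (Nat.gcd_dvd_left b d)
  obtain ⟨d', hd'⟩ := (Nat.gcd_dvd_right a (Nat.gcd b d)).trans (Nat.gcd_dvd_right b d)
  refine ⟨_, a', b', d', hc, Nat.eq_of_mul_eq_mul_left hc ?_, ha, hb, hd'⟩
  rw [← Nat.gcd_mul_left, ← Nat.gcd_mul_left, ← ha, ← hb, ← hd', mul_one]

lemma sum_card_triReps {s : ℕ} (hs : 0 < s) :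
    ∑ k ∈ sqDivisors s, (triReps (s / k ^ 2)).card = ∑ d ∈ s.divisors, d := by
  have hdiv : ∀ k ∈ sqDivisors s, 0 < s / k ^ 2 := fun k hk ↦ by
    rw [mem_sqDivisors hs] at hk
    have := pos_of_sq_dvd hs hk
    exact Nat.div_pos (Nat.le_of_dvd hs hk) (by positivity)
  rw [← Finset.card_sigma, show ∑ d ∈ s.divisors, d = ∑ d ∈ s.divisors, (Finset.range d).card by
    simp, ← Finset.card_sigma]
  let g : (_ : ℕ) × ℕ → ℕ := fun x ↦ Nat.gcd (s / x.1) (Nat.gcd x.2 x.1)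
  refine Finset.card_nbij' (fun x ↦ ⟨x.1 * x.2.2.2, x.1 * x.2.2.1⟩)
    (fun x ↦ ⟨g x, s / x.1 / g x, x.2 / g x, x.1 / g x⟩) ?_ ?_ ?_ ?_
  · rintro ⟨k, a, b, d⟩ hx
    simp only [Finset.coe_sigma, Set.mem_sigma_iff, Finset.mem_coe] at hx
    obtain ⟨hk, ht⟩ := hx
    have hpos := hdiv k hk
    rw [mem_sqDivisors hs] at hk
    rw [mem_triReps hpos] at ht
    have hk0 := pos_of_sq_dvd hs hk
    simp only [Finset.coe_sigma, Set.mem_sigma_iff, Finset.mem_coe, Nat.mem_divisors,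
      Finset.mem_range]
    refine ⟨⟨⟨k * a, ?_⟩, hs.ne'⟩, Nat.mul_lt_mul_of_pos_left ht.2.2 hk0⟩
    rw [← Nat.mul_div_cancel' hk, ← ht.1]
    ring
  · rintro ⟨d, b⟩ hx
    simp only [Finset.coe_sigma, Set.mem_sigma_iff, Finset.mem_coe, Nat.mem_divisors,
      Finset.mem_range] at hx
    obtain ⟨⟨⟨a, rfl⟩, -⟩, hb⟩ := hx
    have hd : 0 < d := Nat.pos_of_mul_pos_right hs
    obtain ⟨c, a, b, d, hc, hg, rfl, rfl, rfl⟩ := exists_eq_mul_gcd_eq_one a b hd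
    have hgc : g ⟨c * d, c * b⟩ = c := by
      simp only [g]
      rw [Nat.mul_div_cancel_left _ hd, Nat.gcd_mul_left, Nat.gcd_mul_left, hg, mul_one]
    have hs' : c * d * (c * a) = c ^ 2 * (a * d) := by ring
    have had : 0 < a * d := Nat.pos_of_mul_pos_left (hs' ▸ hs)
    simp only [Finset.coe_sigma, Set.mem_sigma_iff, Finset.mem_coe, hgc]
    rw [mem_sqDivisors hs, Nat.mul_div_cancel_left _ hd, hs',
      Nat.mul_div_cancel_left _ (by positivity), Nat.mul_div_cancel_left _ hc,
      Nat.mul_div_cancel_left _ hc, Nat.mul_div_cancel_left _ hc, mem_triReps had]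
    exact ⟨Nat.dvd_mul_right _ _, rfl, hg, lt_of_mul_lt_mul_left hb (Nat.zero_le c)⟩
  · rintro ⟨k, a, b, d⟩ hx
    simp only [Finset.coe_sigma, Set.mem_sigma_iff, Finset.mem_coe] at hx
    obtain ⟨hk, ht⟩ := hx
    have hpos := hdiv k hk
    rw [mem_sqDivisors hs] at hk
    rw [mem_triReps hpos] at ht
    obtain ⟨had, hg, -⟩ := ht
    have hk0 := pos_of_sq_dvd hs hk
    have hd : 0 < d := Nat.pos_of_mul_pos_left (had ▸ hpos)
    have hsd : s / (k * d) = k * a := by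
      rw [← Nat.mul_div_cancel' hk, ← had, show k ^ 2 * (a * d) = k * d * (k * a) by ring,
        Nat.mul_div_cancel_left _ (by positivity)]
    have hgk : g ⟨k * d, k * b⟩ = k := by
      simp only [g]
      rw [hsd, Nat.gcd_mul_left, Nat.gcd_mul_left, hg, mul_one]
    simp only [hgk, hsd, Nat.mul_div_cancel_left _ hk0]
  · rintro ⟨d, b⟩ hx
    have h1 : g ⟨d, b⟩ ∣ d := (Nat.gcd_dvd_right _ _).trans (Nat.gcd_dvd_right _ _)
    have h2 : g ⟨d, b⟩ ∣ b := (Nat.gcd_dvd_right _ _).trans (Nat.gcd_dvd_left _ _)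
    simp only [Nat.mul_div_cancel' h1, Nat.mul_div_cancel' h2]

lemma dvd_of_sq_mul_eq_sq_mul {k l m n : ℕ} (hk : 0 < k) (hn : Squarefree n)
    (h : k ^ 2 * m = l ^ 2 * n) : k ∣ l := by
  obtain ⟨x, y, hxy, hx, hy⟩ := Nat.exists_coprime k l
  have hg : 0 < Nat.gcd k l := Nat.gcd_pos_of_pos_left _ hk
  generalize Nat.gcd k l = c at hx hy hg
  subst hx hy
  have hmn : x ^ 2 * m = y ^ 2 * n := by
    refine Nat.eq_of_mul_eq_mul_left (pow_pos hg 2) ?_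
    linear_combination h
  have hxn : x * x ∣ n := by
    rw [← sq]
    exact (hxy.pow 2 2).dvd_of_dvd_mul_left (Dvd.intro m hmn)
  rw [Nat.isUnit_iff.mp (hn x hxn), one_mul]
  exact Nat.dvd_mul_left _ _

lemma sum_psi {s : ℕ} (hs : 0 < s) :
    ∑ k ∈ sqDivisors s, psi (s / k ^ 2) = ∑ d ∈ s.divisors, d := by
  simp only [psi, ← Finset.sum_filter]
  rw [Finset.sum_sigma', ← Nat.sum_div_divisors s fun d ↦ d]
  have hmem : ∀ k m, (⟨k, m⟩ : (_ : ℕ) × ℕ) ∈ (sqDivisors s).sigma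
      (fun k ↦ (s / k ^ 2).divisors.filter Squarefree) ↔ k ^ 2 * m ∣ s ∧ Squarefree m := by
    intro k m
    simp only [Finset.mem_sigma, mem_sqDivisors hs, Finset.mem_filter, Nat.mem_divisors]
    constructor
    · rintro ⟨hk, ⟨hm, -⟩, hsf⟩
      exact ⟨Nat.mul_dvd_of_dvd_div hk hm, hsf⟩
    · rintro ⟨hkm, hsf⟩
      have hk : k ^ 2 ∣ s := dvd_of_mul_right_dvd hkm
      exact ⟨hk, ⟨(Nat.dvd_div_iff_mul_dvd hk).mpr hkm,
        (Nat.div_pos (Nat.le_of_dvd hs hk) (pow_pos (pos_of_sq_dvd hs hk) 2)).ne'⟩, hsf⟩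
  refine Finset.sum_nbij (fun x ↦ x.1 ^ 2 * x.2) ?_ ?_ ?_ ?_
  · rintro ⟨k, m⟩ hx
    exact Nat.mem_divisors.mpr ⟨((hmem k m).mp hx).1, hs.ne'⟩
  · rintro ⟨k, m⟩ hx ⟨l, n⟩ hy hxy
    obtain ⟨hkm, hm⟩ := (hmem k m).mp hx
    obtain ⟨hln, hn⟩ := (hmem l n).mp hy
    have hk := pos_of_sq_dvd hs (dvd_of_mul_right_dvd hkm)
    have hl := pos_of_sq_dvd hs (dvd_of_mul_right_dvd hln)
    simp only at hxy
    obtain rfl := Nat.dvd_antisymm (dvd_of_sq_mul_eq_sq_mul hk hn hxy)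
      (dvd_of_sq_mul_eq_sq_mul hl hm hxy.symm)
    obtain rfl := Nat.eq_of_mul_eq_mul_left (pow_pos hk 2) hxy
    rfl
  · intro e he
    obtain ⟨m, k, rfl, hm⟩ := Nat.sq_mul_squarefree e
    exact ⟨⟨k, m⟩, (hmem k m).mpr ⟨Nat.dvd_of_mem_divisors he, hm⟩, rfl⟩
  · rintro ⟨k, m⟩ -
    exact Nat.div_div_eq_div_mul s (k ^ 2) m

lemma card_triReps {s : ℕ} (hs : 0 < s) : (triReps s).card = psi s :=
  eq_of_sum_sqDivisors_eq (f := fun s ↦ (triReps s).card)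
    (fun _ h ↦ (sum_card_triReps h).trans (sum_psi h).symm) hs

/-- The triangular matrices with entries in `triReps s` form a system of orbit
representatives. -/
lemma exists_isOrbitReps_triangular {s : ℕ} (hs : 0 < s) :
    ∃ R : Fin (psi s) → Mat, IsOrbitReps s R ∧
      ∀ ν, ∃ a b d : ℕ, 0 < a ∧ 0 < d ∧ a * d = s ∧ R ν = !![(a : ℤ), b; 0, d] := by
  let e := ((triReps s).equivFinOfCardEq (card_triReps hs)).symm
  let R : Fin (psi s) → Mat := fun ν ↦
    !![((e ν).1.1 : ℤ), ((e ν).1.2.1 : ℤ); 0, ((e ν).1.2.2 : ℤ)]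
  have hR : ∀ ν, ∃ a b d : ℕ, (e ν).1 = (a, b, d) ∧ 0 < a ∧ a * d = s ∧
      Nat.gcd a (Nat.gcd b d) = 1 ∧ b < d ∧ R ν = !![(a : ℤ), b; 0, d] := by
    intro ν
    obtain ⟨had, hg, hb⟩ := (mem_triReps hs).mp (e ν).2
    exact ⟨_, _, _, rfl, Nat.pos_of_mul_pos_right (had ▸ hs), had, hg, hb, rfl⟩
  refine ⟨R, ⟨fun ν ↦ ?_, fun T hT hdet ↦ ?_⟩, fun ν ↦ ?_⟩
  · obtain ⟨a, b, d, -, -, had, hg, -, hν⟩ := hR ν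
    rw [hν, Mat.isPrimitive_triangular_iff, Matrix.det_fin_two_of]
    exact ⟨hg, by push_cast [← had]; ring⟩
  · obtain ⟨a, b, d, ha, hb, had, hTt⟩ := exists_leftEquiv_triangular hs hdet
    have hg := Mat.isPrimitive_triangular_iff.mp (hTt.isPrimitive hT)
    obtain ⟨ν, hν⟩ := e.surjective ⟨(a, b, d), (mem_triReps hs).mpr ⟨had, hg, hb⟩⟩
    refine ⟨ν, by simpa [R, hν] using hTt, fun μ hμ ↦ e.injective (Subtype.ext ?_)⟩
    obtain ⟨a', b', d', heq, ha', -, -, hb', hRμ⟩ := hR μ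
    obtain ⟨rfl, rfl, rfl⟩ := LeftEquiv.triangular_eq ha ha' hb hb'
      (hTt.symm.trans (hRμ ▸ hμ))
    rw [heq, hν]
  · obtain ⟨a, b, d, -, ha, had, -, hb, hν⟩ := hR ν
    exact ⟨a, b, d, ha, Nat.zero_lt_of_lt hb, had, hν⟩

/-- If s > 1 is not a perfect square, the leading coefficient of
J_s(X,X) ∈ ℤ[X] is ±1. -/
theorem stmt5 (s : ℕ) (hs : 1 < s) (hsq : ¬ IsSquare s) (J : Polynomial (Polynomial ℤ))
    (hJ : IsModularPoly s J) :
    (diagPoly J).leadingCoeff = 1 ∨ (diagPoly J).leadingCoeff = -1 := by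
  obtain ⟨R, hR, htri⟩ := exists_isOrbitReps_triangular (zero_lt_one.trans hs)
  exact (abs_eq zero_le_one).mp (abs_leadingCoeff_diagPoly_eq_one hsq hJ hR htri)

end
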